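/- arXiv:1904.09209 — 5 statements merged into one kernel-verified Lean document; each statement's English description precedes it below -/
import Mathlib

section
/- Let x ∈ Ω, let g ∈ ℝⁿ, and let d ∈ ℝⁿ satisfy condition (4) at (x, g). Then d_i g_i = 0 for all i = 1, …, n if and only if for every i the first-order stationarity conditions hold: g_i = 0 whenever l_i < x_i < u_i, g_i ≥ 0 whenever x_i = l_i, and g_i ≤ 0 whenever x_i = u_i. -/
/-- A vector `d` of diagonal scaling entries satisfies condition (4) at `(x, g)`. -/
def SatCond4 {n : ℕ} (l u x g d : Fin n → ℝ) : Prop :=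
  ∀ i,
    (x i = l i ∧ 0 < g i → d i = 0) ∧
    (x i = u i ∧ g i < 0 → d i = 0) ∧
    (g i = 0 → 0 ≤ d i) ∧
    (¬(x i = l i ∧ 0 < g i) → ¬(x i = u i ∧ g i < 0) → g i ≠ 0 → 0 < d i)

/-- D(x)∇f(x) = 0 iff first-order stationarity. -/
theorem scaled_gradient_zero_iff_stationary {n : ℕ}
    (l u : Fin n → ℝ) (hlu : ∀ i, l i < u i)
    (x : Fin n → ℝ) (hx : ∀ i, l i ≤ x i ∧ x i ≤ u i)
    (g d : Fin n → ℝ) (hd : SatCond4 l u x g d) :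
    (∀ i, d i * g i = 0) ↔
      (∀ i, (l i < x i ∧ x i < u i → g i = 0) ∧
            (x i = l i → 0 ≤ g i) ∧
            (x i = u i → g i ≤ 0)) := by
  refine forall_congr' fun i => ?_
  obtain ⟨h1, h2, -, h4⟩ := hd i
  obtain ⟨hl, hu⟩ := hx i
  have hlt := hlu i
  rw [mul_eq_zero]
  constructor
  · intro h
    refine ⟨fun hin => ?_, fun hxl => ?_, fun hxu => ?_⟩
    · by_contra hg
      have := h4 (fun c => by linarith [c.1, hin.1]) (fun c => by linarith [c.1, hin.2]) hg
      rcases h with h | h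
      · linarith
      · exact hg h
    · by_contra! hg
      have := h4 (fun c => by linarith [c.2]) (fun c => by linarith [c.1]) hg.ne
      rcases h with h | h <;> linarith
    · by_contra! hg
      have := h4 (fun c => by linarith [c.1]) (fun c => by linarith [c.2]) hg.ne'
      rcases h with h | h <;> linarith
  · rintro ⟨a, b, c⟩
    rcases hl.eq_or_lt with hl | hl
    · rcases (b hl.symm).eq_or_lt with hg | hg
      · exact Or.inr hg.symm
      · exact Or.inl (h1 ⟨hl.symm, hg⟩)
    · rcases hu.eq_or_lt with hu | hu
      · rcases (c hu).eq_or_lt with hg | hg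
        · exact Or.inr hg
        · exact Or.inl (h2 ⟨hu, hg⟩)
      · exact Or.inr (a ⟨hl, hu⟩)
end

section
/- Fix γ > 0. For every x ∈ Ω and every g ∈ ℝⁿ, the Kanzow–Klug scaling vector d^KK(x, g) satisfies condition (4) at (x, g). -/
/-- The Kanzow–Klug scaling vector, with parameter `γ`. -/
def dKK {n : ℕ} (γ : ℝ) (l u x g : Fin n → ℝ) (i : Fin n) : ℝ :=
  min (x i - l i + γ * max 0 (-(g i))) (u i - x i + γ * max 0 (g i))

/-- the Kanzow–Klug scaling satisfies condition (4). -/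
theorem dKK_satisfies_cond4 {n : ℕ} (γ : ℝ) (hγ : 0 < γ)
    (l u : Fin n → ℝ) (hlu : ∀ i, l i < u i)
    (x : Fin n → ℝ) (hx : ∀ i, l i ≤ x i ∧ x i ≤ u i)
    (g : Fin n → ℝ) :
    SatCond4 l u x g (dKK γ l u x g) := by
  intro i
  have h := hlu i
  obtain ⟨h1, h2⟩ := hx i
  unfold dKK
  rcases lt_trichotomy (g i) 0 with hg | hg | hg
  · have hp : 0 < γ * (-(g i)) := mul_pos hγ (by linarith)
    rw [max_eq_right (by linarith : (0:ℝ) ≤ -(g i)), max_eq_left hg.le, mul_zero]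
    refine ⟨fun hh => by linarith [hh.2], fun hh => ?_, fun hh => by linarith, fun _ hb _ => ?_⟩
    · rw [min_eq_right (by linarith [hh.1])]
      linarith [hh.1]
    · have hxu : x i < u i := lt_of_le_of_ne h2 (fun e => hb ⟨e, hg⟩)
      exact lt_min (by linarith) (by linarith)
  · rw [hg]
    refine ⟨fun hh => absurd hh.2 (lt_irrefl _), fun hh => absurd hh.2 (lt_irrefl _),
      fun _ => ?_, fun _ _ hb => absurd rfl hb⟩
    simp only [neg_zero, max_self, mul_zero, add_zero]
    exact le_min (by linarith) (by linarith)
  · have hp : 0 < γ * g i := mul_pos hγ hg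
    rw [max_eq_left (by linarith : -(g i) ≤ (0:ℝ)), max_eq_right hg.le, mul_zero]
    refine ⟨fun hh => ?_, fun hh => by linarith [hh.2], fun hh => by linarith, fun ha _ _ => ?_⟩
    · rw [min_eq_left (by linarith [hh.1])]
      linarith [hh.1]
    · have hxl : l i < x i := lt_of_le_of_ne h1 (fun e => ha ⟨e.symm, hg⟩)
      exact lt_min (by linarith) (by linarith)
end

section
/- Let x ∈ Ω, g ∈ ℝⁿ, and let λ ≥ 0 satisfy λ·|g_i| ≤ 1 for all i = 1, …, n. Then the point x − λ·D^CL(x, g)·g obtained by moving from x along the scaled negative gradient direction with the Coleman–Li scaling remains in Ω; that is, l_i ≤ x_i − λ·d^CL_i(x, g)·g_i ≤ u_i for every i. Consequently, the step size to the boundary of Ω from x along −D^CL(x,g)g is at least 1/max_i |g_i|. -/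
/-- The Coleman–Li scaling vector. -/
noncomputable def dCL {n : ℕ} (l u x g : Fin n → ℝ) (i : Fin n) : ℝ :=
  if g i < 0 then u i - x i
  else if 0 < g i then x i - l i
  else min (x i - l i) (u i - x i)

/-- stepping from `x ∈ Ω` along `-D^CL(x,g) g` with step size
`λ ≥ 0` satisfying `λ|gᵢ| ≤ 1` for all `i` keeps the iterate in Ω; hence the
step size to the boundary is at least `1 / maxᵢ |gᵢ|`. -/
theorem dCL_step_stays_in_box {n : ℕ}
    (l u : Fin n → ℝ) (hlu : ∀ i, l i < u i)
    (x : Fin n → ℝ) (hx : ∀ i, l i ≤ x i ∧ x i ≤ u i)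
    (g : Fin n → ℝ)
    (lam : ℝ) (hlam : 0 ≤ lam) (hlamg : ∀ i, lam * |g i| ≤ 1) :
    ∀ i, l i ≤ x i - lam * (dCL l u x g i * g i) ∧
         x i - lam * (dCL l u x g i * g i) ≤ u i := by
  intro i
  obtain ⟨h1, h2⟩ := hx i
  have hg := hlamg i
  unfold dCL
  split_ifs with ha hb
  · rw [abs_of_neg ha] at hg
    have h0 : 0 ≤ lam * -g i := mul_nonneg hlam (by linarith)
    have hp := mul_nonneg h0 (sub_nonneg.2 h2)
    have hq := mul_le_mul_of_nonneg_right hg (sub_nonneg.2 h2)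
    constructor <;> linarith
  · rw [abs_of_pos hb] at hg
    have h0 : 0 ≤ lam * g i := mul_nonneg hlam hb.le
    have hp := mul_nonneg h0 (sub_nonneg.2 h1)
    have hq := mul_le_mul_of_nonneg_right hg (sub_nonneg.2 h1)
    constructor <;> linarith
  · have h0 : g i = 0 := le_antisymm (not_lt.1 hb) (not_lt.1 ha)
    simp [h0, h1, h2]
end

section
/- Fix γ > 0. Let x ∈ Ω, g ∈ ℝⁿ, and let λ ≥ 0 satisfy λ·|g_i| ≤ 1 for all i = 1, …, n. Then the point x − λ·D^KK(x, g)·g remains in Ω; that is, l_i ≤ x_i − λ·d^KK_i(x, g)·g_i ≤ u_i for every i. Consequently, the step size to the boundary of Ω from x along −D^KK(x,g)g is at least 1/max_i |g_i|. -/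
/-- stepping from `x ∈ Ω` along `-D^KK(x,g) g` with step size
`λ ≥ 0` satisfying `λ|gᵢ| ≤ 1` for all `i` keeps the iterate in Ω; hence the
step size to the boundary is at least `1 / maxᵢ |gᵢ|`. -/
theorem dKK_step_stays_in_box {n : ℕ} (γ : ℝ) (hγ : 0 < γ)
    (l u : Fin n → ℝ) (hlu : ∀ i, l i < u i)
    (x : Fin n → ℝ) (hx : ∀ i, l i ≤ x i ∧ x i ≤ u i)
    (g : Fin n → ℝ)
    (lam : ℝ) (hlam : 0 ≤ lam) (hlamg : ∀ i, lam * |g i| ≤ 1) :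
    ∀ i, l i ≤ x i - lam * (dKK γ l u x g i * g i) ∧
         x i - lam * (dKK γ l u x g i * g i) ≤ u i := by
  intro i
  obtain ⟨h1, h2⟩ := hx i
  have hg := hlamg i
  have hm1 : 0 ≤ γ * max 0 (-(g i)) := mul_nonneg hγ.le (le_max_left _ _)
  have hm2 : 0 ≤ γ * max 0 (g i) := mul_nonneg hγ.le (le_max_left _ _)
  have hd0 : 0 ≤ dKK γ l u x g i := le_min (by linarith) (by linarith)
  have e : lam * (dKK γ l u x g i * g i) = dKK γ l u x g i * (lam * g i) := by ring
  rw [e]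
  rcases le_total 0 (g i) with h | h
  · have hd : dKK γ l u x g i ≤ x i - l i := by
      have : dKK γ l u x g i ≤ x i - l i + γ * max 0 (-(g i)) := min_le_left _ _
      rwa [max_eq_left (by linarith), mul_zero, add_zero] at this
    rw [abs_of_nonneg h] at hg
    have a := mul_nonneg hd0 (mul_nonneg hlam h)
    have b := mul_le_mul_of_nonneg_left hg hd0
    constructor <;> linarith
  · have hd : dKK γ l u x g i ≤ u i - x i := by
      have : dKK γ l u x g i ≤ u i - x i + γ * max 0 (g i) := min_le_right _ _
      rwa [max_eq_left h, mul_zero, add_zero] at this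
    rw [abs_of_nonpos h] at hg
    have a := mul_nonneg hd0 (mul_nonneg hlam (neg_nonneg.2 h))
    have b := mul_le_mul_of_nonneg_left hg hd0
    simp only [mul_neg, mul_one] at a b
    constructor <;> linarith
end

section
/- Fix α > 0. Let x ∈ Ω, g ∈ ℝⁿ, and let λ ∈ [0, 1]. Then the point x − λ·D^HMZ(x, g)·g remains in Ω; that is, l_i ≤ x_i − λ·d^HMZ_i(x, g)·g_i ≤ u_i for every i. Consequently, the step size to the boundary of Ω from x along −D^HMZ(x,g)g is at least 1, independently of g. -/
/-- The Hager–Mair–Zhang scaling vector, with parameter `α`. -/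
noncomputable def dHMZ {n : ℕ} (α : ℝ) (l u x g : Fin n → ℝ) (i : Fin n) : ℝ :=
  (if g i < 0 then u i - x i else if 0 < g i then x i - l i else 1) /
    (α * (if g i < 0 then u i - x i else if 0 < g i then x i - l i else 1) + |g i|)

/-- The scalar bound behind the result. -/
theorem hmz_scalar {α c t lam : ℝ} (hα : 0 < α) (hc : 0 ≤ c) (ht : 0 < t)
    (h0 : 0 ≤ lam) (h1 : lam ≤ 1) :
    0 ≤ lam * (c / (α * c + t) * t) ∧ lam * (c / (α * c + t) * t) ≤ c := by
  have hp : 0 ≤ α * c := mul_nonneg hα.le hc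
  have hd : 0 < α * c + t := by linarith
  have hb : 0 ≤ c / (α * c + t) * t := by positivity
  have hle : c / (α * c + t) * t ≤ c := by
    rw [div_mul_eq_mul_div, div_le_iff₀ hd]
    nlinarith [mul_nonneg hc hp]
  exact ⟨mul_nonneg h0 hb, (mul_le_of_le_one_left hb h1).trans hle⟩

/-- stepping from `x ∈ Ω` along `-D^HMZ(x,g) g` with any step
size `λ ∈ [0,1]` keeps the iterate in Ω; hence the step size to the boundary
is at least `1`, independently of `g`. -/
theorem dHMZ_step_stays_in_box {n : ℕ} (α : ℝ) (hα : 0 < α)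
    (l u : Fin n → ℝ) (hlu : ∀ i, l i < u i)
    (x : Fin n → ℝ) (hx : ∀ i, l i ≤ x i ∧ x i ≤ u i)
    (g : Fin n → ℝ)
    (lam : ℝ) (hlam0 : 0 ≤ lam) (hlam1 : lam ≤ 1) :
    ∀ i, l i ≤ x i - lam * (dHMZ α l u x g i * g i) ∧
         x i - lam * (dHMZ α l u x g i * g i) ≤ u i := by
  intro i
  obtain ⟨hl, hu⟩ := hx i
  rcases lt_trichotomy (g i) 0 with h | h | h
  · obtain ⟨h1, h2⟩ := hmz_scalar (c := u i - x i) (t := -g i) hα (by linarith)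
      (by linarith) hlam0 hlam1
    simp only [dHMZ, if_pos h, abs_of_neg h]
    rw [mul_neg, mul_neg] at h1 h2
    constructor <;> linarith
  · simp [h, hl, hu]
  · obtain ⟨h1, h2⟩ := hmz_scalar (c := x i - l i) (t := g i) hα (by linarith)
      h hlam0 hlam1
    simp only [dHMZ, if_neg h.not_gt, if_pos h, abs_of_pos h]
    constructor <;> linarith
end
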